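/- Let e_j(t) = c_j Ai(t − ζ'_j) be the L²(0,∞)-normalized Neumann eigenfunctions of the Airy operator D_t² + t, where −ζ'_j are the zeros of Ai'. Then there exists a constant c_1 > 0 such that |e_j(0)|² = c_1 j^{−2/3}(1 + o(1)) as j → ∞. -/

import Mathlib

open Filter Asymptotics Real MeasureTheory Set

/-- The derivative of a convergent function on a half-line tends to zero if it is monotone. -/
theorem tendsto_zero_of_hasDerivAt_of_monotoneOn {w w' : ℝ → ℝ} {a l : ℝ}
    (hw : ∀ t, HasDerivAt w (w' t) t) (hmono : MonotoneOn w' (Ici a))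
    (hlim : Tendsto w atTop (nhds l)) : Tendsto w' atTop (nhds 0) := by
  have hsucc : Tendsto (fun t => w (t + 1) - w t) atTop (nhds 0) := by
    simpa using (hlim.comp (tendsto_atTop_add_const_right atTop (1 : ℝ) tendsto_id)).sub hlim
  have hpred : Tendsto (fun t => w t - w (t - 1)) atTop (nhds 0) := by
    simpa [← sub_eq_add_neg] using
      hlim.sub (hlim.comp (tendsto_atTop_add_const_right atTop (-1 : ℝ) tendsto_id))
  have hcont : Continuous w := continuous_iff_continuousAt.2 fun t => (hw t).continuousAt
  refine tendsto_of_tendsto_of_tendsto_of_le_of_le' hpred hsucc ?_ ?_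
  · filter_upwards [eventually_ge_atTop (a + 1)] with t ht
    obtain ⟨c, hc, h⟩ := exists_hasDerivAt_eq_slope w w' (sub_one_lt t) hcont.continuousOn
      fun x _ => hw x
    have := hmono (show a ≤ c by linarith [hc.1]) (show a ≤ t by linarith) hc.2.le
    simpa [h] using this
  · filter_upwards [eventually_ge_atTop a] with t ht
    obtain ⟨c, hc, h⟩ := exists_hasDerivAt_eq_slope w w' (lt_add_one t) hcont.continuousOn
      fun x _ => hw x
    have := hmono (show a ≤ t from ht) (show a ≤ c by linarith [hc.1]) hc.1.le
    simpa [h] using this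

/-- A primitive of the square of a solution of the Airy equation. -/
theorem hasDerivAt_airy_primitive {u u' : ℝ → ℝ} (hu : ∀ t, HasDerivAt u (u' t) t)
    (hu' : ∀ t, HasDerivAt u' (t * u t) t) (t : ℝ) :
    HasDerivAt (fun t => t * u t ^ 2 - u' t ^ 2) (u t ^ 2) t := by
  refine (((hasDerivAt_id t).mul ((hu t).pow 2)).sub ((hu' t).pow 2)).congr_deriv ?_
  simp
  ring

theorem tendsto_airy_primitive {u u' : ℝ → ℝ} (hu : ∀ t, HasDerivAt u (u' t) t)
    (hu' : ∀ t, HasDerivAt u' (t * u t) t) (hlim : Tendsto u atTop (nhds 0)) :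
    Tendsto (fun t => t * u t ^ 2 - u' t ^ 2) atTop (nhds 0) := by
  have hcu : Continuous u := continuous_iff_continuousAt.2 fun t => (hu t).continuousAt
  have hcu' : Continuous u' := continuous_iff_continuousAt.2 fun t => (hu' t).continuousAt
  have hw : ∀ t, HasDerivAt (fun t => u t ^ 2) (2 * u t * u' t) t := fun t =>
    ((hu t).pow 2).congr_deriv (by simp)
  have hp : ∀ t, HasDerivAt (fun t => 2 * u t * u' t) (2 * u' t ^ 2 + 2 * (t * u t ^ 2)) t :=
    fun t => (((hu t).const_mul 2).mul (hu' t)).congr_deriv (by ring)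
  have hmono : MonotoneOn (fun t => 2 * u t * u' t) (Ici 0) := by
    refine monotoneOn_of_deriv_nonneg (convex_Ici 0) (by fun_prop)
      (fun t _ => (hp t).differentiableAt.differentiableWithinAt) fun t ht => ?_
    rw [interior_Ici, mem_Ioi] at ht
    rw [(hp t).deriv]
    positivity
  have hp0 := tendsto_zero_of_hasDerivAt_of_monotoneOn hw hmono (by simpa using hlim.pow 2)
  have hint : IntegrableOn (fun t => 2 * u' t ^ 2 + 2 * (t * u t ^ 2)) (Ioi 1) := by
    refine integrableOn_Ioi_deriv_of_nonneg (hp 1).continuousAt.continuousWithinAt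
      (fun t _ => hp t) (fun t ht => ?_) hp0
    have : (0 : ℝ) < t := zero_lt_one.trans ht
    positivity
  refine tendsto_zero_of_hasDerivAt_of_integrableOn_Ioi (a := 1)
    (fun t _ => hasDerivAt_airy_primitive hu hu' t) ?_ ?_
  · refine hint.mono' (by fun_prop) ?_
    filter_upwards [ae_restrict_mem measurableSet_Ioi] with t ht
    rw [mem_Ioi] at ht
    rw [Real.norm_eq_abs, abs_of_nonneg (sq_nonneg _)]
    nlinarith [sq_nonneg (u t), sq_nonneg (u' t)]
  · refine hint.mono' (by fun_prop) ?_
    filter_upwards [ae_restrict_mem measurableSet_Ioi] with t ht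
    rw [mem_Ioi] at ht
    have : 0 ≤ t * u t ^ 2 := by positivity
    rw [Real.norm_eq_abs, abs_le]
    constructor <;> nlinarith [sq_nonneg (u' t)]

theorem integral_Ioi_airy_sq {u u' : ℝ → ℝ} (hu : ∀ t, HasDerivAt u (u' t) t)
    (hu' : ∀ t, HasDerivAt u' (t * u t) t) (hlim : Tendsto u atTop (nhds 0)) (a : ℝ) :
    ∫ t in Ioi a, u t ^ 2 = u' a ^ 2 - a * u a ^ 2 := by
  rw [integral_Ioi_of_hasDerivAt_of_nonneg
    (hasDerivAt_airy_primitive hu hu' a).continuousAt.continuousWithinAt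
    (fun t _ => hasDerivAt_airy_primitive hu hu' t) (fun t _ => sq_nonneg _)
    (tendsto_airy_primitive hu hu' hlim)]
  ring

/-- Vanishing Cauchy data of a solution of the Airy equation propagates to the right. -/
theorem airy_eq_zero_of_le {u u' : ℝ → ℝ} (hu : ∀ t, HasDerivAt u (u' t) t)
    (hu' : ∀ t, HasDerivAt u' (t * u t) t) {s t : ℝ} (hst : s ≤ t)
    (h0 : u s ^ 2 + u' s ^ 2 = 0) : u t = 0 := by
  have hG : ∀ x, HasDerivAt (fun x => (u x ^ 2 + u' x ^ 2) * exp (-(2 * x + x ^ 3 / 3)))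
      ((2 * u x * u' x * (1 + x) - (2 + x ^ 2) * (u x ^ 2 + u' x ^ 2)) *
        exp (-(2 * x + x ^ 3 / 3))) x := by
    intro x
    have hW : HasDerivAt (fun x : ℝ => -(2 * x + x ^ 3 / 3)) (-(2 + x ^ 2)) x := by
      refine ((((hasDerivAt_id x).const_mul 2).add
        (((hasDerivAt_id x).pow 3).div_const 3)).neg).congr_deriv ?_
      simp
    refine ((((hu x).pow 2).add ((hu' x).pow 2)).mul hW.exp).congr_deriv ?_
    simp
    ring
  have hanti : Antitone (fun x => (u x ^ 2 + u' x ^ 2) * exp (-(2 * x + x ^ 3 / 3))) := by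
    refine antitone_of_deriv_nonpos (fun x => (hG x).differentiableAt) fun x => ?_
    rw [(hG x).deriv]
    refine mul_nonpos_of_nonpos_of_nonneg ?_ (exp_pos _).le
    nlinarith [sq_nonneg (u x - u' x), sq_nonneg (u x - x * u' x),
      sq_nonneg (u' x - x * u x), sq_nonneg (u x), sq_nonneg (u' x)]
  have h := hanti hst
  simp only [h0, zero_mul] at h
  have h' : u t ^ 2 + u' t ^ 2 ≤ 0 := nonpos_of_mul_nonpos_left h (exp_pos _)
  nlinarith [sq_nonneg (u t), sq_nonneg (u' t)]

/-- A modified Prüfer angle. -/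
theorem exists_prufer_angle {c d : ℝ → ℝ} {a : ℝ} (ha : 0 < a)
    (hc : ∀ x, 0 < x → HasDerivAt c (c x / (2 * x) - √x * d x) x)
    (hd : ∀ x, 0 < x → HasDerivAt d (√x * c x) x)
    (hR : ∀ x, 0 < x → 0 < c x ^ 2 + d x ^ 2) (hda : d a = 0) :
    ∃ θ : ℝ → ℝ, θ a = 0 ∧ ∀ x, a ≤ x →
      HasDerivAt θ (√x - c x * d x / (c x ^ 2 + d x ^ 2) / (2 * x)) x ∧
      (d x = 0 ↔ sin (θ x) = 0) := by
  set g : ℝ → ℝ := fun x => √x - c x * d x / (c x ^ 2 + d x ^ 2) / (2 * x) with hg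
  have hcc : ContinuousOn c (Ioi 0) := fun x hx => (hc x hx).continuousAt.continuousWithinAt
  have hdc : ContinuousOn d (Ioi 0) := fun x hx => (hd x hx).continuousAt.continuousWithinAt
  have hgc : ContinuousOn g (Ioi 0) := by
    refine continuous_sqrt.continuousOn.sub (((hcc.mul hdc).div ((hcc.pow 2).add (hdc.pow 2))
      fun x hx => (hR x hx).ne').div (by fun_prop) fun x hx => ?_)
    have : (0 : ℝ) < x := hx
    positivity
  have hGc : Continuous fun x => g (max x a) :=
    hgc.comp_continuous (by fun_prop) fun x => lt_max_of_lt_right ha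
  set θ : ℝ → ℝ := fun x => ∫ t in a..x, g (max t a) with hθdef
  have hθ0 : θ a = 0 := by simp [hθdef]
  have hθ : ∀ x, a ≤ x → HasDerivAt θ (g x) x := fun x hx => by
    have := (hGc.integral_hasStrictDerivAt a x).hasDerivAt
    rwa [max_eq_left hx] at this
  have hE : ∀ x, a ≤ x → HasDerivAt
      (fun x => (d x * cos (θ x) - c x * sin (θ x)) ^ 2 / (c x ^ 2 + d x ^ 2)) 0 x := by
    intro x hx
    have hx0 : 0 < x := ha.trans_le hx
    have hRx := (hR x hx0).ne'
    have hE := (((hd x hx0).mul (hθ x hx).cos).sub ((hc x hx0).mul (hθ x hx).sin)).pow 2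
    refine (hE.div (((hc x hx0).pow 2).add ((hd x hx0).pow 2)) hRx).congr_deriv ?_
    simp only [hg, Pi.mul_apply, Pi.sub_apply, Pi.add_apply, Pi.pow_apply]
    field_simp
    simp
    ring
  have hzero : ∀ x, a ≤ x → d x * cos (θ x) - c x * sin (θ x) = 0 := by
    intro x hx
    have hconst := constant_of_has_deriv_right_zero (a := a) (b := x)
      (fun y hy => (hE y hy.1).continuousAt.continuousWithinAt)
      (fun y hy => (hE y hy.1).hasDerivWithinAt) x ⟨hx, le_rfl⟩
    simp only [hθ0, hda] at hconst
    simpa [(hR x (ha.trans_le hx)).ne'] using hconst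
  refine ⟨θ, hθ0, fun x hx => ⟨hθ x hx, fun h => ?_, fun h => ?_⟩⟩
  · have h1 := hzero x hx
    have h2 := hR x (ha.trans_le hx)
    rw [h] at h1 h2
    have : c x ≠ 0 := by
      intro h3
      simp [h3] at h2
    simpa [this] using h1
  · have h1 := hzero x hx
    have h2 := sin_sq_add_cos_sq (θ x)
    rw [h] at h1 h2
    have : cos (θ x) ≠ 0 := by
      intro h3
      simp [h3] at h2
    simpa [this] using h1

theorem abs_mul_div_sq_add_sq_le (c d : ℝ) : |c * d / (c ^ 2 + d ^ 2)| ≤ 1 / 2 := by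
  rw [abs_div, abs_mul, abs_of_nonneg (by positivity : 0 ≤ c ^ 2 + d ^ 2)]
  refine div_le_of_le_mul₀ (by positivity) (by norm_num) ?_
  nlinarith [sq_nonneg (|c| - |d|), sq_abs c, sq_abs d]

/-- Asymptotics for the Prüfer angle of a solution of the Airy equation on `(-∞, -a]`. -/
theorem exists_airy_angle {u u' : ℝ → ℝ} (hu : ∀ t, HasDerivAt u (u' t) t)
    (hu' : ∀ t, HasDerivAt u' (t * u t) t) (hne : ∀ x, 0 < x → 0 < u (-x) ^ 2 + u' (-x) ^ 2)
    {a : ℝ} (ha : 1 ≤ a) (hua : u' (-a) = 0) :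
    ∃ θ : ℝ → ℝ, θ a = 0 ∧ ContinuousOn θ (Ici a) ∧ StrictMonoOn θ (Ici a) ∧
      (∀ x, a ≤ x → (u' (-x) = 0 ↔ sin (θ x) = 0)) ∧
      ∀ x, a ≤ x → |θ x - (2 / 3 * x ^ (3 / 2 : ℝ) - 2 / 3 * a ^ (3 / 2 : ℝ))| ≤ x := by
  have ha0 : 0 < a := by linarith
  have hv : ∀ x, HasDerivAt (fun x => u (-x)) (-u' (-x)) x := fun x =>
    ((hu (-x)).scomp x (hasDerivAt_neg x)).congr_deriv (by simp)
  have hd : ∀ x, 0 < x → HasDerivAt (fun x => u' (-x)) (√x * (√x * u (-x))) x := fun x hx => by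
    refine ((hu' (-x)).scomp x (hasDerivAt_neg x)).congr_deriv ?_
    rw [← mul_assoc, mul_self_sqrt hx.le]
    simp
  have hc : ∀ x, 0 < x → HasDerivAt (fun x => √x * u (-x))
      (√x * u (-x) / (2 * x) - √x * u' (-x)) x := fun x hx => by
    refine ((hasDerivAt_sqrt hx.ne').mul (hv x)).congr_deriv ?_
    have hs : √x ≠ 0 := (sqrt_pos.2 hx).ne'
    have : x = √x * √x := (mul_self_sqrt hx.le).symm
    generalize √x = s at *
    subst this
    field_simp
    ring
  have hR : ∀ x, 0 < x → 0 < (√x * u (-x)) ^ 2 + u' (-x) ^ 2 := fun x hx => by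
    have h1 := hne x hx
    rw [mul_pow, sq_sqrt hx.le]
    rcases eq_or_ne (u (-x)) 0 with h | h
    · simpa [h] using h1
    · positivity
  obtain ⟨θ, hθ0, hθ⟩ := exists_prufer_angle ha0 hc hd hR hua
  have hbd : ∀ x, a ≤ x → |√x * u (-x) * u' (-x) / ((√x * u (-x)) ^ 2 + u' (-x) ^ 2) / (2 * x)|
      ≤ 1 / 2 := fun x hx => by
    have hx1 : 1 ≤ x := ha.trans hx
    rw [abs_div, abs_of_pos (by positivity : 0 < 2 * x)]
    refine (div_le_self (abs_nonneg _) (by linarith)).trans (abs_mul_div_sq_add_sq_le _ _)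
  have hcont : ContinuousOn θ (Ici a) := fun x hx => (hθ x hx).1.continuousAt.continuousWithinAt
  refine ⟨θ, hθ0, hcont, ?_, fun x hx => (hθ x hx).2, fun x hx => ?_⟩
  · refine strictMonoOn_of_deriv_pos (convex_Ici a) hcont fun x hx => ?_
    rw [interior_Ici] at hx
    have hx : a ≤ x := le_of_lt hx
    rw [(hθ x hx).1.deriv]
    have h1 : 1 ≤ √x := one_le_sqrt.2 (ha.trans hx)
    linarith [(abs_le.1 (hbd x hx)).2]
  · have hder : ∀ y ∈ Ici a, HasDerivWithinAt (fun y => θ y - 2 / 3 * y ^ (3 / 2 : ℝ))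
        (-(√y * u (-y) * u' (-y) / ((√y * u (-y)) ^ 2 + u' (-y) ^ 2) / (2 * y))) (Ici a) y := by
      intro y hy
      have hy0 : 0 < y := ha0.trans_le hy
      refine ((hθ y hy).1.sub ((Real.hasDerivAt_rpow_const (p := 3 / 2)
        (Or.inl hy0.ne')).const_mul (2 / 3))).hasDerivWithinAt.congr_deriv ?_
      rw [show (3 / 2 : ℝ) - 1 = 1 / 2 by norm_num, ← sqrt_eq_rpow]
      ring
    have h := (convex_Ici a).norm_image_sub_le_of_norm_hasDerivWithin_le hder
      (fun y hy => by rw [norm_neg]; exact hbd y hy) self_mem_Ici hx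
    rw [hθ0, Real.norm_eq_abs, Real.norm_eq_abs, abs_of_nonneg (sub_nonneg.2 hx)] at h
    rw [show θ x - (2 / 3 * x ^ (3 / 2 : ℝ) - 2 / 3 * a ^ (3 / 2 : ℝ)) =
      θ x - 2 / 3 * x ^ (3 / 2 : ℝ) - (0 - 2 / 3 * a ^ (3 / 2 : ℝ)) by ring]
    linarith

/-- A strictly increasing enumeration of the zeros of a function with nonzero slope at its
zeros is unbounded. -/
theorem tendsto_atTop_of_simple_zeros {f f' : ℝ → ℝ} {ζ : ℕ → ℝ} (hpos : ∀ j, 0 < ζ j)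
    (hmono : StrictMono ζ) (hf : ∀ x, 0 < x → HasDerivAt f (f' x) x)
    (hsimple : ∀ x, 0 < x → f x = 0 → f' x ≠ 0) (hzero : ∀ j, f (ζ j) = 0) :
    Tendsto ζ atTop atTop := by
  rcases tendsto_atTop_of_monotone hmono.monotone with h | ⟨L, hL⟩
  · exact h
  have hlt : ∀ j, ζ j < L := fun j =>
    (hmono (Nat.lt_succ_self j)).trans_le (hmono.monotone.ge_of_tendsto hL _)
  have hL0 : 0 < L := (hpos 0).trans (hlt 0)
  have hfL : f L = 0 := by
    refine tendsto_nhds_unique ((hf L hL0).continuousAt.tendsto.comp hL) ?_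
    simp [Function.comp_def, hzero]
  have hne := (hf L hL0).eventually_ne (c := 0) (hsimple L hL0 hfL)
  have hL' : Tendsto ζ atTop (nhdsWithin L {L}ᶜ) :=
    tendsto_nhdsWithin_iff.2 ⟨hL, Eventually.of_forall fun j => (hlt j).ne⟩
  obtain ⟨j, hj⟩ := (hL'.eventually hne).exists
  exact absurd (hzero j) hj

/-- A continuous increasing angle takes the value `k * π` at the `k`-th zero of its sine. -/
theorem angle_eq_nat_mul_pi {θ : ℝ → ℝ} {ζ : ℕ → ℝ} (hmono : StrictMono ζ)
    (h0 : θ (ζ 0) = 0) (hcont : ContinuousOn θ (Ici (ζ 0))) (hθ : StrictMonoOn θ (Ici (ζ 0)))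
    (hsin : ∀ k, sin (θ (ζ k)) = 0)
    (hall : ∀ x, ζ 0 ≤ x → sin (θ x) = 0 → ∃ k, ζ k = x) (k : ℕ) : θ (ζ k) = k * π := by
  have hge : ∀ k, ζ 0 ≤ ζ k := fun k => hmono.monotone (Nat.zero_le k)
  induction k with
  | zero => simpa using h0
  | succ k ih =>
    obtain ⟨m, hm⟩ := sin_eq_zero_iff.1 (hsin (k + 1))
    have hlt : θ (ζ k) < θ (ζ (k + 1)) := hθ (hge _) (hge _) (hmono k.lt_succ_self)
    rw [ih, ← hm] at hlt
    have hkm : (k : ℤ) < m := by exact_mod_cast lt_of_mul_lt_mul_right hlt pi_pos.le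
    rcases (Int.add_one_le_iff.2 hkm).eq_or_lt with h | h
    · rw [← hm, ← h]
      push_cast
      ring
    have hmem : ((k : ℝ) + 1) * π ∈ Icc (θ (ζ k)) (θ (ζ (k + 1))) := by
      rw [ih, ← hm]
      have h' : ((k : ℝ) + 1) ≤ m := by exact_mod_cast h.le
      constructor <;> nlinarith [pi_pos]
    obtain ⟨x, hx, hxe⟩ := intermediate_value_Icc (hmono k.lt_succ_self).le
      (hcont.mono fun y hy => (hge k).trans hy.1) hmem
    obtain ⟨i, rfl⟩ := hall x ((hge k).trans hx.1)
      (by rw [hxe]; exact_mod_cast sin_nat_mul_pi (k + 1))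
    have h1 : k ≤ i := hmono.le_iff_le.1 hx.1
    have h2 : i ≤ k + 1 := hmono.le_iff_le.1 hx.2
    rcases (show i = k ∨ i = k + 1 by omega) with rfl | rfl
    · nlinarith [pi_pos]
    · exact_mod_cast hxe

/-- The asymptotics of a sequence `ζ` with `n π = (2/3) ζ ^ (3/2) + O(ζ)`. -/
theorem isEquivalent_inv_of_abs_sub_le {ζ : ℕ → ℝ} {A : ℝ} {N : ℕ} (hζ : Tendsto ζ atTop atTop)
    (h : ∀ k : ℕ, |k * π - (2 / 3 * ζ (N + k) ^ (3 / 2 : ℝ) - A)| ≤ ζ (N + k)) :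
    (fun j => 1 / ζ j) ~[atTop]
      fun j => (2 / (3 * π)) ^ (2 / 3 : ℝ) * ((j : ℝ) + 1) ^ (-(2 : ℝ) / 3) := by
  have hpow : Tendsto (fun j => ζ j ^ (3 / 2 : ℝ)) atTop atTop :=
    (tendsto_rpow_atTop (by norm_num)).comp hζ
  have hratio : Tendsto (fun j : ℕ => ((j : ℝ) + 1) / ζ j ^ (3 / 2 : ℝ)) atTop
      (nhds (2 / (3 * π))) := by
    have hsmall : Tendsto (fun j => ζ j ^ (-(1 / 2) : ℝ)) atTop (nhds 0) :=
      (tendsto_rpow_neg_atTop (by norm_num)).comp hζ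
    have herr : Tendsto (fun j : ℕ => (((j : ℝ) - N) * π - (2 / 3 * ζ j ^ (3 / 2 : ℝ) - A)) /
        ζ j ^ (3 / 2 : ℝ)) atTop (nhds 0) := by
      refine squeeze_zero_norm' ?_ hsmall
      filter_upwards [eventually_ge_atTop N, hζ.eventually_gt_atTop 0] with j hj hj0
      obtain ⟨k, rfl⟩ := Nat.exists_eq_add_of_le hj
      have := h k
      rw [norm_div, Real.norm_eq_abs, Real.norm_eq_abs, abs_of_pos (rpow_pos_of_pos hj0 _),
        div_le_iff₀ (rpow_pos_of_pos hj0 _), ← rpow_add hj0]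
      norm_num
      simpa using this
    have hconst : Tendsto (fun j : ℕ => (((N : ℝ) + 1) * π - A) / ζ j ^ (3 / 2 : ℝ)) atTop
        (nhds 0) :=
      hpow.const_div_atTop _
    have := ((herr.add hconst).add_const (2 / 3)).div_const π
    rw [show (0 + 0 + 2 / 3) / π = 2 / (3 * π) by field_simp; ring] at this
    refine this.congr' ?_
    filter_upwards [hpow.eventually_gt_atTop 0] with j hj
    field_simp
    ring
  have hc : 0 < 2 / (3 * π) := by positivity
  have hroot : Tendsto (fun j : ℕ => ((j : ℝ) + 1) ^ (2 / 3 : ℝ) / ζ j) atTop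
      (nhds ((2 / (3 * π)) ^ (2 / 3 : ℝ))) := by
    refine (hratio.rpow_const (p := 2 / 3) (Or.inl hc.ne')).congr' ?_
    filter_upwards [hζ.eventually_gt_atTop 0] with j hj
    rw [div_rpow (by positivity) (by positivity), ← rpow_mul hj.le]
    norm_num
  have hcp := rpow_pos_of_pos hc (2 / 3)
  refine isEquivalent_of_tendsto_one ?_
  have := hroot.div_const ((2 / (3 * π)) ^ (2 / 3 : ℝ))
  rw [div_self hcp.ne'] at this
  refine this.congr' ?_
  filter_upwards [hζ.eventually_gt_atTop 0] with j hj
  have hj1 : (0 : ℝ) < (j : ℝ) + 1 := by positivity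
  have := rpow_pos_of_pos hj1 (2 / 3)
  rw [Pi.div_apply, neg_div, rpow_neg hj1.le]
  field_simp

/-- With `Ai` the Airy function, `ζ j` the increasing enumeration of the negatives of the
zeros of `Ai'` (`ζ j` being the `(j+1)`-st one), and
`e_j(t) = Ai(t − ζ'_j)/‖Ai‖_{L²(−ζ'_j,∞)}` the normalized Neumann Airy eigenfunctions,
there is `c₁ > 0` with `|e_j(0)|² = c₁ j^{−2/3}(1 + o(1))` as `j → ∞`. -/
theorem neumann_eigenfunction_boundary_value_asymptotics
    (Ai : ℝ → ℝ) (hAi : ContDiff ℝ ⊤ Ai)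
    (hODE : ∀ t : ℝ, deriv (deriv Ai) t = t * Ai t)
    (hdecay : Tendsto Ai atTop (nhds 0))
    (hnorm : Ai 0 = 1 / (3 ^ ((2:ℝ)/3) * Real.Gamma (2/3)))
    (ζ : ℕ → ℝ) (hpos : ∀ j, 0 < ζ j) (hmono : StrictMono ζ)
    (hzero : ∀ j, deriv Ai (-(ζ j)) = 0)
    (hall : ∀ x : ℝ, 0 < x → deriv Ai (-x) = 0 → ∃ j, ζ j = x) :
    ∃ c₁ > (0:ℝ),
      (fun j : ℕ => (Ai (-(ζ j))) ^ 2 / ∫ t in Ioi (-(ζ j)), (Ai t) ^ 2) ~[atTop]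
        (fun j : ℕ => c₁ * ((j:ℝ) + 1) ^ (-(2:ℝ)/3)) := by
  have hdAi : ContDiff ℝ 1 (deriv Ai) :=
    (contDiff_succ_iff_deriv.1 (hAi.of_le le_top : ContDiff ℝ (1 + 1) Ai)).2.2
  have hu : ∀ t, HasDerivAt Ai (deriv Ai t) t := fun t =>
    (hAi.differentiable (by simp) t).hasDerivAt
  have hu' : ∀ t, HasDerivAt (deriv Ai) (t * Ai t) t := fun t => by
    rw [← hODE t]
    exact (hdAi.differentiable (by simp) t).hasDerivAt
  have hAi0 : Ai 0 ≠ 0 := by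
    have : 0 < Real.Gamma (2 / 3) := Real.Gamma_pos_of_pos (by norm_num)
    rw [hnorm]
    positivity
  have hne : ∀ x, 0 < x → 0 < Ai (-x) ^ 2 + deriv Ai (-x) ^ 2 := fun x hx =>
    lt_of_le_of_ne (by positivity) fun h =>
      hAi0 (airy_eq_zero_of_le hu hu' (neg_nonpos.2 hx.le) h.symm)
  have hne' : ∀ x, 0 < x → deriv Ai (-x) = 0 → Ai (-x) ≠ 0 := fun x hx h h' => by
    have := hne x hx
    simp [h, h'] at this
  have hζ : Tendsto ζ atTop atTop := by
    refine tendsto_atTop_of_simple_zeros (f := fun x => deriv Ai (-x))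
      (f' := fun x => x * Ai (-x)) hpos hmono (fun x _ => ?_)
      (fun x hx h => mul_ne_zero hx.ne' (hne' x hx h)) hzero
    exact ((hu' (-x)).scomp x (hasDerivAt_neg x)).congr_deriv (by simp)
  obtain ⟨N, hN⟩ := (hζ.eventually_ge_atTop 1).exists
  obtain ⟨θ, hθ0, hθc, hθm, hθs, hθ⟩ := exists_airy_angle hu hu' hne hN (hzero N)
  have hge : ∀ k, ζ N ≤ ζ (N + k) := fun k => hmono.monotone (Nat.le_add_right N k)
  have hangle := angle_eq_nat_mul_pi (ζ := fun k => ζ (N + k))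
    (fun i j hij => hmono (Nat.add_lt_add_left hij N)) hθ0 hθc hθm
    (fun k => (hθs _ (hge k)).1 (hzero _)) fun x hx hs => by
      obtain ⟨i, rfl⟩ := hall x (zero_lt_one.trans_le (hN.trans hx)) ((hθs x hx).2 hs)
      obtain ⟨k, rfl⟩ := Nat.exists_eq_add_of_le (hmono.le_iff_le.1 hx)
      exact ⟨k, rfl⟩
  refine ⟨(2 / (3 * π)) ^ (2 / 3 : ℝ), by positivity, ?_⟩
  refine (isEquivalent_inv_of_abs_sub_le (A := 2 / 3 * ζ N ^ (3 / 2 : ℝ)) (N := N) hζ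
    fun k => ?_).congr_left (Eventually.of_forall fun j => ?_)
  · rw [← hangle k]
    exact hθ _ (hge k)
  · have h1 := hne' _ (hpos j) (hzero j)
    have h2 := (hpos j).ne'
    simp only [integral_Ioi_airy_sq hu hu' hdecay, hzero j]
    field_simp
    simp
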